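/- arXiv:2311.04580 — 6 statements merged into one kernel-verified Lean document; each statement's English description precedes it below -/
import Mathlib

section
/- Let K ∈ ℝ^{m×n} and let M ∈ ℝ satisfy M > |K_{i,j}| for all i, j. Suppose there exist l ∈ ℝ, matrices K⁺, K⁻ ∈ ℝ^{m×n}, a vector c ∈ ℝ^n, and binary vectors δ^(1),…,δ^(m), δ^(m+1) ∈ {0,1}^n such that: (i) K = K⁺ − K⁻; (ii) 0 ≤ K⁺_{i,j} ≤ M·δ^(i)_j for all i, j; (iii) 0 ≤ K⁻_{i,j} ≤ M·(1 − δ^(i)_j) for all i, j; (iv) c_j = ∑_{i=1}^m (K⁺_{i,j} + K⁻_{i,j}) for all j; (v) c_j ≤ l ≤ c_j + M·(1 − δ^(m+1)_j) for all j; and (vi) ∑_{j=1}^n δ^(m+1)_j = 1. Then l = ‖K‖₁. -/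
/-- The induced matrix 1-norm: maximum absolute column sum. -/
noncomputable def matNorm1 {m n : ℕ} [NeZero n] (K : Matrix (Fin m) (Fin n) ℝ) : ℝ :=
  Finset.univ.sup' Finset.univ_nonempty fun j => ∑ i, |K i j|

/-- Lemma 1: the MI feasibility conditions characterize the induced 1-norm. -/
theorem stmt_0 {m n : ℕ} [NeZero n] (K Kp Km : Matrix (Fin m) (Fin n) ℝ)
    (M l : ℝ) (c : Fin n → ℝ)
    (δ : Fin m → Fin n → ℝ) (δ' : Fin n → ℝ)
    (hM : ∀ i j, |K i j| < M)
    (hδbin : ∀ i j, δ i j = 0 ∨ δ i j = 1)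
    (hδ'bin : ∀ j, δ' j = 0 ∨ δ' j = 1)
    (hK : K = Kp - Km)
    (hKp : ∀ i j, 0 ≤ Kp i j ∧ Kp i j ≤ M * δ i j)
    (hKm : ∀ i j, 0 ≤ Km i j ∧ Km i j ≤ M * (1 - δ i j))
    (hc : ∀ j, c j = ∑ i, (Kp i j + Km i j))
    (hl : ∀ j, c j ≤ l ∧ l ≤ c j + M * (1 - δ' j))
    (hδ'sum : ∑ j, δ' j = 1) :
    l = matNorm1 K := by
  have hcK : ∀ j, c j = ∑ i, |K i j| := by
    intro j
    rw [hc j]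
    refine Finset.sum_congr rfl fun i _ => ?_
    obtain ⟨hp0, hp1⟩ := hKp i j
    obtain ⟨hm0, hm1⟩ := hKm i j
    rw [hK, Matrix.sub_apply]
    rcases hδbin i j with h | h <;> rw [h] at hp1 hm1
    · rw [abs_of_nonpos (by linarith)]
      linarith
    · rw [abs_of_nonneg (by linarith)]
      linarith
  obtain ⟨j₀, hj₀⟩ : ∃ j, δ' j = 1 := by
    by_contra! h
    have h_zero : ∀ j, δ' j = 0 := fun j => (hδ'bin j).resolve_right (h j)
    simp [h_zero] at hδ'sum
  unfold matNorm1
  apply le_antisymm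
  · have hle := (hl j₀).2
    rw [hj₀, hcK j₀] at hle
    calc l ≤ ∑ i, |K i j₀| := by linarith
      _ ≤ _ := Finset.le_sup' (fun j => ∑ i, |K i j|) (Finset.mem_univ j₀)
  · exact Finset.sup'_le _ _ fun j _ => hcK j ▸ (hl j).1
end

section
/- Let K ∈ ℝ^{m×n} and let M ∈ ℝ satisfy M > |K_{i,j}| for all i, j. Suppose there exist l ∈ ℝ, matrices K⁺, K⁻ ∈ ℝ^{m×n}, a vector c ∈ ℝ^m, and binary vectors δ^(1),…,δ^(n), δ^(n+1) ∈ {0,1}^m such that: (i) K = K⁺ − K⁻; (ii) 0 ≤ K⁺_{i,j} ≤ M·δ^(j)_i for all i, j; (iii) 0 ≤ K⁻_{i,j} ≤ M·(1 − δ^(j)_i) for all i, j; (iv) c_i = ∑_{j=1}^n (K⁺_{i,j} + K⁻_{i,j}) for all i; (v) c_i ≤ l ≤ c_i + M·(1 − δ^(n+1)_i) for all i; and (vi) ∑_{i=1}^m δ^(n+1)_i = 1. Then l = ‖K‖_∞. -/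
/-- The induced matrix ∞-norm: maximum absolute row sum. -/
noncomputable def matNormInf {m n : ℕ} [NeZero m] (K : Matrix (Fin m) (Fin n) ℝ) : ℝ :=
  Finset.univ.sup' Finset.univ_nonempty fun i => ∑ j, |K i j|

/-- The MI feasibility conditions characterize the induced ∞-norm. -/
theorem stmt_1 {m n : ℕ} [NeZero m] (K Kp Km : Matrix (Fin m) (Fin n) ℝ)
    (M l : ℝ) (c : Fin m → ℝ)
    (δ : Fin n → Fin m → ℝ) (δ' : Fin m → ℝ)
    (hM : ∀ i j, |K i j| < M)
    (hδbin : ∀ j i, δ j i = 0 ∨ δ j i = 1)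
    (hδ'bin : ∀ i, δ' i = 0 ∨ δ' i = 1)
    (hK : K = Kp - Km)
    (hKp : ∀ i j, 0 ≤ Kp i j ∧ Kp i j ≤ M * δ j i)
    (hKm : ∀ i j, 0 ≤ Km i j ∧ Km i j ≤ M * (1 - δ j i))
    (hc : ∀ i, c i = ∑ j, (Kp i j + Km i j))
    (hl : ∀ i, c i ≤ l ∧ l ≤ c i + M * (1 - δ' i))
    (hδ'sum : ∑ i, δ' i = 1) :
    l = matNormInf K := by
  have hrow : ∀ i, ∑ j, |K i j| = c i := by
    intro i
    rw [hc i]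
    refine Finset.sum_congr rfl fun j _ => ?_
    obtain ⟨hp0, hp⟩ := hKp i j
    obtain ⟨hm0, hm⟩ := hKm i j
    rw [hK, Matrix.sub_apply]
    rcases hδbin j i with h | h
    · rw [h, mul_zero] at hp
      rw [le_antisymm hp hp0, zero_sub, abs_neg, abs_of_nonneg hm0, zero_add]
    · rw [h, sub_self, mul_zero] at hm
      rw [le_antisymm hm hm0, sub_zero, abs_of_nonneg hp0, add_zero]
  obtain ⟨i, hi⟩ : ∃ i, δ' i = 1 := by
    by_contra! hne
    have hzero : ∑ i, δ' i = 0 :=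
      Finset.sum_eq_zero fun i _ => (hδ'bin i).resolve_right (hne i)
    exact zero_ne_one (hzero.symm.trans hδ'sum)
  simp only [matNormInf, hrow]
  apply le_antisymm
  · have hle := (hl i).2
    rw [hi, sub_self, mul_zero, add_zero] at hle
    exact hle.trans (Finset.le_sup' c (Finset.mem_univ i))
  · exact Finset.sup'_le _ _ fun k _ => (hl k).1
end

section
/- Let K, K⁺, K⁻ ∈ ℝ^{m×n}, M ∈ ℝ, and let δ^(1),…,δ^(m) ∈ {0,1}^n be binary vectors such that K = K⁺ − K⁻, 0 ≤ K⁺_{i,j} ≤ M·δ^(i)_j, and 0 ≤ K⁻_{i,j} ≤ M·(1 − δ^(i)_j) for all i, j. Then for all i, j one has K⁺_{i,j} = max(K_{i,j}, 0), K⁻_{i,j} = max(−K_{i,j}, 0), and consequently K⁺_{i,j} + K⁻_{i,j} = |K_{i,j}|. -/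
/-- The big-M conditions with binary selectors force the positive/negative part
decomposition of a matrix. -/
theorem stmt_2 {m n : ℕ} (K Kp Km : Matrix (Fin m) (Fin n) ℝ) (M : ℝ)
    (δ : Fin m → Fin n → ℝ)
    (hδbin : ∀ i j, δ i j = 0 ∨ δ i j = 1)
    (hK : K = Kp - Km)
    (hKp : ∀ i j, 0 ≤ Kp i j ∧ Kp i j ≤ M * δ i j)
    (hKm : ∀ i j, 0 ≤ Km i j ∧ Km i j ≤ M * (1 - δ i j)) :
    ∀ i j, Kp i j = max (K i j) 0 ∧ Km i j = max (-K i j) 0 ∧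
      Kp i j + Km i j = |K i j| := by
  intro i j
  have h_entry : K i j = Kp i j - Km i j := by rw [hK, Matrix.sub_apply]
  obtain ⟨hp, hp'⟩ := hKp i j
  obtain ⟨hm, hm'⟩ := hKm i j
  rw [h_entry]
  rcases hδbin i j with h | h
  · have h0 : Kp i j = 0 := le_antisymm (by simpa [h] using hp') hp
    simp [h0, hm, abs_of_nonneg hm]
  · have h0 : Km i j = 0 := le_antisymm (by simpa [h] using hm') hm
    simp [h0, hp, abs_of_nonneg hp]
end

section
/- Let q ∈ ℕ and let λ, r, λ̄, r̄ ∈ ℝ^q with λ ≤ λ̄ and r ≤ r̄ componentwise. Then the following are equivalent: (a) r ≥ 0, λ ≥ 0, and λ_i·r_i = 0 for every i ∈ {1,…,q}; (b) there exists a binary vector δ ∈ {0,1}^q such that 0 ≤ r_i ≤ r̄_i·(1 − δ_i) and 0 ≤ λ_i ≤ λ̄_i·δ_i for every i ∈ {1,…,q}. -/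
/-- Complementarity conditions are equivalent to the big-M mixed-integer
reformulation with a binary vector. -/
theorem stmt_4 {q : ℕ} (lam r lamBar rBar : Fin q → ℝ)
    (hlam : ∀ i, lam i ≤ lamBar i) (hr : ∀ i, r i ≤ rBar i) :
    ((∀ i, 0 ≤ r i) ∧ (∀ i, 0 ≤ lam i) ∧ (∀ i, lam i * r i = 0)) ↔
      (∃ δ : Fin q → ℝ, (∀ i, δ i = 0 ∨ δ i = 1) ∧
        (∀ i, 0 ≤ r i ∧ r i ≤ rBar i * (1 - δ i)) ∧
        (∀ i, 0 ≤ lam i ∧ lam i ≤ lamBar i * δ i)) := by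
  constructor
  · rintro ⟨hr0, hlam0, hcomp⟩
    refine ⟨fun i => if r i = 0 then 1 else 0, fun i => ?_, fun i => ⟨hr0 i, ?_⟩,
      fun i => ⟨hlam0 i, ?_⟩⟩
    · by_cases h : r i = 0 <;> simp [h]
    · by_cases h : r i = 0
      · simp [h]
      · simpa [h] using hr i
    · by_cases h : r i = 0
      · simpa [h] using hlam i
      · have hl : lam i = 0 := (mul_eq_zero.mp (hcomp i)).resolve_right h
        simp [h, hl]
  · rintro ⟨δ, hδ, hrδ, hlamδ⟩
    refine ⟨fun i => (hrδ i).1, fun i => (hlamδ i).1, fun i => ?_⟩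
    obtain ⟨hr0, hr1⟩ := hrδ i
    obtain ⟨hl0, hl1⟩ := hlamδ i
    rcases hδ i with h | h
    · have hl : lam i = 0 := le_antisymm (by simpa [h] using hl1) hl0
      simp [hl]
    · have hri : r i = 0 := le_antisymm (by simpa [h] using hr1) hr0
      simp [hri]
end

section
/- Fix an index i ∈ {1,…,q}. Suppose there exists no MI point (x, U, λ, r, δ) with δ_i = 1. Then every bounded KKT point (x, U, λ, r) satisfies G_i U < E_i x + d_i, i.e., r_i > 0, where G_i, E_i, d_i denote the i-th row of G, the i-th row of E, and the i-th entry of d. -/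
open Matrix

/-- A bounded KKT point of the parametric QP. -/
def IsBoundedKKT {n p q : ℕ} (H : Matrix (Fin p) (Fin p) ℝ) (F : Matrix (Fin p) (Fin n) ℝ)
    (G : Matrix (Fin q) (Fin p) ℝ) (E : Matrix (Fin q) (Fin n) ℝ) (d : Fin q → ℝ)
    (lamBar rBar : Fin q → ℝ)
    (x : Fin n → ℝ) (U : Fin p → ℝ) (lam r : Fin q → ℝ) : Prop :=
  H.mulVec U + F.mulVec x + Gᵀ.mulVec lam = 0 ∧
  r = E.mulVec x + d - G.mulVec U ∧
  (∀ i, 0 ≤ r i) ∧ (∀ i, 0 ≤ lam i) ∧ (∀ i, lam i * r i = 0) ∧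
  (∀ i, lam i ≤ lamBar i) ∧ (∀ i, r i ≤ rBar i)

/-- An MI (mixed-integer) point of the big-M reformulation. -/
def IsMIPoint {n p q : ℕ} (H : Matrix (Fin p) (Fin p) ℝ) (F : Matrix (Fin p) (Fin n) ℝ)
    (G : Matrix (Fin q) (Fin p) ℝ) (E : Matrix (Fin q) (Fin n) ℝ) (d : Fin q → ℝ)
    (lamBar rBar : Fin q → ℝ)
    (x : Fin n → ℝ) (U : Fin p → ℝ) (lam r : Fin q → ℝ) (δ : Fin q → ℝ) : Prop :=
  H.mulVec U + F.mulVec x + Gᵀ.mulVec lam = 0 ∧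
  r = E.mulVec x + d - G.mulVec U ∧
  (∀ i, δ i = 0 ∨ δ i = 1) ∧
  (∀ i, 0 ≤ r i ∧ r i ≤ rBar i * (1 - δ i)) ∧
  (∀ i, 0 ≤ lam i ∧ lam i ≤ lamBar i * δ i)

/-- Lemma 2: if no MI point activates constraint `i`, then every bounded KKT
point satisfies the `i`-th constraint strictly. -/
theorem stmt_5 {n p q : ℕ} (H : Matrix (Fin p) (Fin p) ℝ) (F : Matrix (Fin p) (Fin n) ℝ)
    (G : Matrix (Fin q) (Fin p) ℝ) (E : Matrix (Fin q) (Fin n) ℝ) (d : Fin q → ℝ)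
    (lamBar rBar : Fin q → ℝ)
    (hlamBar : ∀ i, 0 < lamBar i) (hrBar : ∀ i, 0 < rBar i)
    (i : Fin q)
    (hinfeas : ¬ ∃ (x : Fin n → ℝ) (U : Fin p → ℝ) (lam r δ : Fin q → ℝ),
      IsMIPoint H F G E d lamBar rBar x U lam r δ ∧ δ i = 1) :
    ∀ (x : Fin n → ℝ) (U : Fin p → ℝ) (lam r : Fin q → ℝ),
      IsBoundedKKT H F G E d lamBar rBar x U lam r →
        G i ⬝ᵥ U < E i ⬝ᵥ x + d i ∧ 0 < r i := by
  classical
  rintro x U lam r ⟨hstat, hr, hr0, hlam0, hcomp, hlamle, hrle⟩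
  have hpos : 0 < r i := by
    refine lt_of_le_of_ne (hr0 i) fun hri => hinfeas ?_
    refine ⟨x, U, lam, r, fun j => if r j = 0 then 1 else 0,
      ⟨hstat, hr, fun j => ?_, fun j => ⟨hr0 j, ?_⟩, fun j => ⟨hlam0 j, ?_⟩⟩, if_pos hri.symm⟩
    · by_cases h : r j = 0 <;> simp [h]
    · by_cases h : r j = 0
      · simp [h]
      · simpa [h] using hrle j
    · by_cases h : r j = 0
      · simpa [h] using hlamle j
      · simp [h, (mul_eq_zero.mp (hcomp j)).resolve_right h]
  have hri : r i = E i ⬝ᵥ x + d i - G i ⬝ᵥ U := congrFun hr i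
  exact ⟨by linarith, hpos⟩
end

section
/- Let X ⊆ ℝ^n, let f be a function defined on X ∪ ΘX with values in ℝ^m, let Ω ∈ ℝ^{m×m} and let Θ ∈ ℝ^{n×n} be invertible, where ΘX := {Θx : x ∈ X}. Suppose Ω f(x) = f(Θ x) for all x ∈ X, ‖Ω‖_∞ ≤ 1, ‖Θ⁻¹‖_∞ ≤ 1, and ‖f(x) − f(x̃)‖_∞ ≤ L ‖x − x̃‖_∞ for all x, x̃ ∈ X. Then ‖f(y) − f(ỹ)‖_∞ ≤ L ‖y − ỹ‖_∞ for all y, ỹ ∈ ΘX. -/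
open Matrix

theorem norm_mulVec_le_matNormInf_mul {m n : ℕ} [NeZero m] (K : Matrix (Fin m) (Fin n) ℝ)
    (v : Fin n → ℝ) : ‖K *ᵥ v‖ ≤ matNormInf K * ‖v‖ := by
  refine (pi_norm_le_iff_of_nonempty _).2 fun i => ?_
  calc ‖(K *ᵥ v) i‖ ≤ ∑ j, ‖K i j * v j‖ := norm_sum_le Finset.univ fun j => K i j * v j
    _ ≤ ∑ j, |K i j| * ‖v‖ := by
        refine Finset.sum_le_sum fun j _ => ?_
        rw [norm_mul, Real.norm_eq_abs (K i j)]
        gcongr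
        exact norm_le_pi_norm v j
    _ = (∑ j, |K i j|) * ‖v‖ := (Finset.sum_mul _ _ _).symm
    _ ≤ matNormInf K * ‖v‖ := by
        gcongr
        exact Finset.le_sup' (fun i => ∑ j, |K i j|) (Finset.mem_univ i)

theorem norm_mulVec_le_of_matNormInf_le_one {m n : ℕ} [NeZero m]
    {K : Matrix (Fin m) (Fin n) ℝ} (hK : matNormInf K ≤ 1) (v : Fin n → ℝ) :
    ‖K *ᵥ v‖ ≤ ‖v‖ :=
  (norm_mulVec_le_matNormInf_mul K v).trans (mul_le_of_le_one_left (norm_nonneg v) hK)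

/-- A Lipschitz estimate (w.r.t. the ∞-norms, which are the sup norms on the
pi types `Fin n → ℝ` and `Fin m → ℝ`) transfers from `X` to `Θ X` along a
symmetry `(Θ, Ω)` with `‖Ω‖_∞ ≤ 1` and `‖Θ⁻¹‖_∞ ≤ 1`. -/
theorem stmt_12 {n m : ℕ} [NeZero n] [NeZero m] (X : Set (Fin n → ℝ))
    (f : (Fin n → ℝ) → Fin m → ℝ)
    (Ω : Matrix (Fin m) (Fin m) ℝ) (Θ : Matrix (Fin n) (Fin n) ℝ)
    (hΘ : IsUnit Θ.det)
    (hsym : ∀ x ∈ X, Ω.mulVec (f x) = f (Θ.mulVec x))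
    (hΩ1 : matNormInf Ω ≤ 1) (hΘinv1 : matNormInf Θ⁻¹ ≤ 1)
    (L : ℝ) (hLip : ∀ x ∈ X, ∀ x' ∈ X, ‖f x - f x'‖ ≤ L * ‖x - x'‖) :
    ∀ y ∈ (fun x => Θ.mulVec x) '' X, ∀ y' ∈ (fun x => Θ.mulVec x) '' X,
      ‖f y - f y'‖ ≤ L * ‖y - y'‖ := by
  rintro _ ⟨x, hx, rfl⟩ _ ⟨x', hx', rfl⟩
  dsimp only
  rcases eq_or_ne x x' with rfl | hne
  · simp
  have hL : 0 ≤ L :=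
    nonneg_of_mul_nonneg_left ((norm_nonneg _).trans (hLip x hx x' hx'))
      (norm_pos_iff.2 (sub_ne_zero.2 hne))
  have hinv : Θ⁻¹ *ᵥ (Θ *ᵥ x - Θ *ᵥ x') = x - x' := by
    rw [← mulVec_sub, mulVec_mulVec, nonsing_inv_mul _ hΘ, one_mulVec]
  calc ‖f (Θ *ᵥ x) - f (Θ *ᵥ x')‖ = ‖Ω *ᵥ (f x - f x')‖ := by
        rw [← hsym x hx, ← hsym x' hx', mulVec_sub]
    _ ≤ ‖f x - f x'‖ := norm_mulVec_le_of_matNormInf_le_one hΩ1 _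
    _ ≤ L * ‖x - x'‖ := hLip x hx x' hx'
    _ ≤ L * ‖Θ *ᵥ x - Θ *ᵥ x'‖ := by
        gcongr
        rw [← hinv]
        exact norm_mulVec_le_of_matNormInf_le_one hΘinv1 _
end
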